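/- Let R > 0, 0 < C < 1/2, α ∈ ℝ, and set M = C·R. For θ_c, μ ∈ ℝ define θ_int(r) = θ_c − (4αC/R²)·ln(R² − 2C r²) on (0, R) and θ_ext(r) = 2α/(M r) + 2α/r² + 8αM/(3r³) + (α/M² − μ/2)·ln(1 − 2M/r) on (2M, ∞). If the derivatives match at the stellar surface, θ_int'(R) = θ_ext'(R), then μ = 0. -/

import Mathlib

open Real

noncomputable section

/-- The regular interior scalar-field solution for a strongly anisotropic constant-density
star of radius `R`, compactness `C`, Gauss-Bonnet coupling `α`, central value `θc`. -/
def θint (R C α θc : ℝ) (r : ℝ) : ℝ :=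
  θc - (4 * α * C / R ^ 2) * Real.log (R ^ 2 - 2 * C * r ^ 2)

/-- The exterior scalar-field solution around a star of mass `M`, Gauss-Bonnet coupling `α`
and scalar monopole charge parameter `μ`. -/
def θext (M α μ : ℝ) (r : ℝ) : ℝ :=
  2 * α / (M * r) + 2 * α / r ^ 2 + 8 * α * M / (3 * r ^ 3)
    + (α / M ^ 2 - μ / 2) * Real.log (1 - 2 * M / r)

theorem hasDerivAt_θint {R C : ℝ} (α θc : ℝ) {r : ℝ} (h : R ^ 2 - 2 * C * r ^ 2 ≠ 0) :
    HasDerivAt (θint R C α θc)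
      ((4 * α * C / R ^ 2) * (4 * C * r / (R ^ 2 - 2 * C * r ^ 2))) r := by
  have hg : HasDerivAt (fun r : ℝ => R ^ 2 - 2 * C * r ^ 2) (-(4 * C * r)) r := by
    refine HasDerivAt.congr_deriv (((hasDerivAt_pow 2 r).const_mul (2 * C)).const_sub (R ^ 2)) ?_
    norm_num
    ring
  refine HasDerivAt.congr_deriv (((hg.log h).const_mul (4 * α * C / R ^ 2)).const_sub θc) ?_
  ring

theorem hasDerivAt_θext {M : ℝ} (α μ : ℝ) {r : ℝ} (hM : M ≠ 0) (hr : r ≠ 0)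
    (h : 1 - 2 * M / r ≠ 0) :
    HasDerivAt (θext M α μ)
      (-(2 * α) / (M * r ^ 2) - 4 * α / r ^ 3 - 8 * α * M / r ^ 4
        + (α / M ^ 2 - μ / 2) * (2 * M / r ^ 2 / (1 - 2 * M / r))) r := by
  have h₁ : HasDerivAt (fun r : ℝ => 2 * α / (M * r)) (-(2 * α) / (M * r ^ 2)) r := by
    refine HasDerivAt.congr_deriv ((hasDerivAt_const r (2 * α)).div ((hasDerivAt_id r).const_mul M)
      (mul_ne_zero hM hr)) ?_
    field_simp
    ring
  have h₂ : HasDerivAt (fun r : ℝ => 2 * α / r ^ 2) (-(4 * α / r ^ 3)) r := by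
    refine HasDerivAt.congr_deriv ((hasDerivAt_const r (2 * α)).div (hasDerivAt_pow 2 r) (pow_ne_zero 2 hr)) ?_
    field_simp
    norm_num
    ring
  have h₃ : HasDerivAt (fun r : ℝ => 8 * α * M / (3 * r ^ 3)) (-(8 * α * M / r ^ 4)) r := by
    refine HasDerivAt.congr_deriv ((hasDerivAt_const r (8 * α * M)).div ((hasDerivAt_pow 3 r).const_mul 3)
      (mul_ne_zero three_ne_zero (pow_ne_zero 3 hr))) ?_
    field_simp
    norm_num
    ring
  have h₄ : HasDerivAt (fun r : ℝ => 1 - 2 * M / r) (2 * M / r ^ 2) r := by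
    refine HasDerivAt.congr_deriv (((hasDerivAt_const r (2 * M)).div (hasDerivAt_id r) hr).const_sub 1) ?_
    simp only [id]
    ring
  refine HasDerivAt.congr_deriv (((h₁.add h₂).add h₃).add ((h₄.log h).const_mul (α / M ^ 2 - μ / 2))) ?_
  ring

/-- Matching the derivatives of the regular interior solution and the exterior solution at
the stellar surface `r = R` (with `M = C·R`, so `2M < R`) forces the scalar monopole charge
`μ` to vanish. -/
theorem anisotropic_matching_kills_charge (R C α θc μ : ℝ) (hR : 0 < R) (hC0 : 0 < C)
    (hC : C < 1 / 2)
    (hmatch : deriv (θint R C α θc) R = deriv (θext (C * R) α μ) R) :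
    μ = 0 := by
  have hC1 : 1 - 2 * C ≠ 0 := by linarith
  have hint : R ^ 2 - 2 * C * R ^ 2 = R ^ 2 * (1 - 2 * C) := by ring
  have hext : 1 - 2 * (C * R) / R = 1 - 2 * C := by field_simp
  have hi : R ^ 2 - 2 * C * R ^ 2 ≠ 0 := by
    rw [hint]
    exact mul_ne_zero (pow_ne_zero 2 hR.ne') hC1
  have he : 1 - 2 * (C * R) / R ≠ 0 := by rwa [hext]
  rw [(hasDerivAt_θint α θc hi).deriv,
    (hasDerivAt_θext α μ (mul_pos hC0 hR).ne' hR.ne' he).deriv, hint, hext] at hmatch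
  have hμ : μ * (C / (R * (1 - 2 * C))) = 0 := by
    have key : (4 * α * C / R ^ 2) * (4 * C * R / (R ^ 2 * (1 - 2 * C)))
        - (-(2 * α) / (C * R * R ^ 2) - 4 * α / R ^ 3 - 8 * α * (C * R) / R ^ 4
          + (α / (C * R) ^ 2 - μ / 2) * (2 * (C * R) / R ^ 2 / (1 - 2 * C)))
        = μ * (C / (R * (1 - 2 * C))) := by
      obtain ⟨D, hD⟩ : ∃ D, D = 1 - 2 * C := ⟨_, rfl⟩
      rw [← hD] at hC1 ⊢
      field_simp
      rw [hD]
      ring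
    rw [← key, hmatch, sub_self]
  exact (mul_eq_zero.mp hμ).resolve_right
    (div_ne_zero hC0.ne' (mul_ne_zero hR.ne' hC1))

end
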